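/- Assume S_λ is densely defined. Then S_λ is hyponormal if and only if for every u ∈ V the following two conditions hold: (1) for every v ∈ Chi(u), if c(v) = 0 then λ(v) = 0; and (2) Σ over {v ∈ Chi(u) : c(v) > 0} of |λ(v)|²/c(v)² is at most 1. -/

import Mathlib

open scoped ENNReal NNReal ComplexConjugate Classical ComplexInnerProductSpace

noncomputable section

/-- `HS V` is the Hilbert space `ℓ²(V)` of square-summable families of complex numbers
indexed by `V`. -/
abbrev HS (V : Type*) : Type _ := lp (fun _ : V => ℂ) 2

/-- A (possibly unbounded) partially defined operator in a Hilbert space `E`: a domain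
together with an assignment of values.  Only the restriction of `toFun` to `dom` is
relevant (e.g. via `POp.graph`). -/
structure POp (E : Type*) [NormedAddCommGroup E] [InnerProductSpace ℂ E] where
  dom : Set E
  toFun : E → E

namespace POp

variable {E : Type*} [NormedAddCommGroup E] [InnerProductSpace ℂ E]

/-- Composition of partially defined operators: `(A.comp B) f = A (B f)` on the natural
domain `{f ∈ dom B : B f ∈ dom A}`. -/
def comp (A B : POp E) : POp E :=
  ⟨{f | f ∈ B.dom ∧ B.toFun f ∈ A.dom}, fun f => A.toFun (B.toFun f)⟩

/-- The graph of a partially defined operator, as a subset of `E × E`. -/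
def graph (A : POp E) : Set (E × E) := {p | p.1 ∈ A.dom ∧ p.2 = A.toFun p.1}

/-- The Hilbert-space adjoint of a (densely defined) partially defined operator `A`:
`g ∈ dom A*` iff there is `h` with `⟪A f, g⟫ = ⟪f, h⟫` for all `f ∈ dom A`, and then
`A* g = h` (`h` is unique when `A` is densely defined). -/
def adj (A : POp E) : POp E :=
  ⟨{g | ∃ h : E, ∀ f ∈ A.dom, ⟪A.toFun f, g⟫ = ⟪f, h⟫},
   fun g => if h : ∃ h' : E, ∀ f ∈ A.dom, ⟪A.toFun f, g⟫ = ⟪f, h'⟫ then h.choose else 0⟩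

end POp

variable {V : Type*}

/-- The element of `ℓ²(V)` with coordinates `g` (junk value `0` if `g` is not
square-summable). -/
def mkH (g : V → ℂ) : HS V := if h : Memℓp g 2 then ⟨g, h⟩ else 0

/-- The standard orthonormal basis vector `e_u` of `ℓ²(V)`. -/
def eV (u : V) : HS V := mkH (fun v => if v = u then 1 else 0)

/-- The weighted shift `S_λ` on the directed tree encoded by the parent map `par`
(with `Chi(u) = {v : par v = u}`), with weights `lam`:
domain `{f : Σ_u (Σ_{v ∈ Chi(u)} |λ v|²)·|f u|² < ∞}` and value
`(S_λ f)(v) = λ v · f (par v)`. -/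
def shiftOp (par : V → V) (lam : V → ℂ) : POp (HS V) :=
  ⟨{f | ∑' u : V, ((∑' v : {v : V // par v = u}, ((‖lam v.1‖₊ : ℝ≥0∞) ^ 2)) *
        (‖f u‖₊ : ℝ≥0∞) ^ 2) < ⊤},
   fun f => mkH (fun v => lam v * f (par v))⟩

/-- `cW par lam u = (Σ_{v ∈ Chi(u)} |λ v|²)^{1/2}`, i.e. `c(u) = ‖S_λ e_u‖`. -/
def cW (par : V → V) (lam : V → ℂ) (u : V) : ℝ :=
  Real.sqrt (∑' v : {v : V // par v = u}, ‖lam v.1‖ ^ 2)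

/-- The squared norm `Σ_{v ∈ Chi(u)} |λ v|²` of `S_λ e_u`, as an extended nonnegative real. -/
def childSq (par : V → V) (lam : V → ℂ) (u : V) : ℝ≥0∞ :=
  ∑' v : {v : V // par v = u}, ‖lam v.1‖ₑ ^ 2

/-- The formal adjoint of `S_λ`, with value `Σ_{v ∈ Chi(u)} conj(λ v) g(v)` at `u`. -/
def shiftFormalAdj (par : V → V) (lam : V → ℂ) (g : V → ℂ) (u : V) : ℂ :=
  ∑' v : {v : V // par v = u}, conj (lam v.1) * g v.1

theorem enorm_sq_eq_ofReal {E : Type*} [NormedAddCommGroup E] (z : E) :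
    ‖z‖ₑ ^ 2 = ENNReal.ofReal (‖z‖ ^ 2) := by
  rw [← ofReal_norm, ENNReal.ofReal_pow (norm_nonneg _)]

theorem memlp_two_iff (g : V → ℂ) : Memℓp g 2 ↔ ∑' v, ‖g v‖ₑ ^ 2 < ⊤ := by
  rw [memℓp_gen_iff (by norm_num)]
  simp only [ENNReal.toReal_ofNat, Real.rpow_ofNat, enorm_sq_eq_ofReal]
  constructor
  · intro h
    rw [← ENNReal.ofReal_tsum_of_nonneg (fun _ => by positivity) h]
    exact ENNReal.ofReal_lt_top
  · intro h
    refine (ENNReal.summable_toReal h.ne).congr fun v => ?_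
    rw [ENNReal.toReal_ofReal (by positivity)]

theorem enorm_sq_eq_tsum (f : HS V) : ‖f‖ₑ ^ 2 = ∑' v, ‖f v‖ₑ ^ 2 := by
  have h := lp.hasSum_norm (p := 2) (by norm_num) f
  simp only [ENNReal.toReal_ofNat, Real.rpow_ofNat] at h
  simp only [enorm_sq_eq_ofReal]
  rw [← h.tsum_eq, ENNReal.ofReal_tsum_of_nonneg (fun _ => by positivity) h.summable]

theorem mkH_apply {g : V → ℂ} (h : Memℓp g 2) (v : V) : mkH g v = g v := by
  simp [mkH, h]

theorem ENNReal.tsum_mul_sq_le {ι : Type*} (f g : ι → ℝ≥0∞) :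
    (∑' i, f i * g i) ^ 2 ≤ (∑' i, f i ^ 2) * ∑' i, g i ^ 2 := by
  have h : ∑' i, f i * g i ≤ (∑' i, f i ^ 2) ^ (1 / 2 : ℝ) * (∑' i, g i ^ 2) ^ (1 / 2 : ℝ) := by
    refine ENNReal.summable.tsum_le_of_sum_le fun s => ?_
    have := ENNReal.inner_le_Lp_mul_Lq s f g Real.HolderConjugate.two_two
    simp only [ENNReal.rpow_ofNat] at this
    refine this.trans ?_
    gcongr <;> exact ENNReal.sum_le_tsum s
  calc _ ≤ _ := pow_le_pow_left' h 2
    _ = _ := by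
      rw [mul_pow, ← ENNReal.rpow_natCast, ← ENNReal.rpow_natCast, ← ENNReal.rpow_mul,
        ← ENNReal.rpow_mul]
      norm_num

theorem cW_nonneg (par : V → V) (lam : V → ℂ) (u : V) : 0 ≤ cW par lam u :=
  Real.sqrt_nonneg _

theorem ofReal_cW_sq {par : V → V} {lam : V → ℂ} {u : V}
    (hl : Summable fun v : {v : V // par v = u} => ‖lam v.1‖ ^ 2) :
    ENNReal.ofReal (cW par lam u ^ 2) = childSq par lam u := by
  rw [cW, Real.sq_sqrt (tsum_nonneg fun _ => by positivity),
    ENNReal.ofReal_tsum_of_nonneg (fun _ => by positivity) hl]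
  simp only [childSq, enorm_sq_eq_ofReal]

theorem mem_shiftOp_dom {par : V → V} {lam : V → ℂ} {f : HS V} :
    f ∈ (shiftOp par lam).dom ↔ ∑' u, childSq par lam u * ‖f u‖ₑ ^ 2 < ⊤ := Iff.rfl

theorem tsum_enorm_shift_sq (par : V → V) (lam f : V → ℂ) :
    ∑' v, ‖lam v * f (par v)‖ₑ ^ 2 = ∑' u, childSq par lam u * ‖f u‖ₑ ^ 2 := by
  rw [← ENNReal.tsum_fiberwise _ par]
  refine tsum_congr fun u => ?_
  rw [childSq, ← ENNReal.tsum_mul_right]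
  refine tsum_congr fun v : {v : V // par v = u} => ?_
  rw [enorm_mul, mul_pow, v.2]

theorem memlp_shift {par : V → V} {lam : V → ℂ} {f : HS V} (hf : f ∈ (shiftOp par lam).dom) :
    Memℓp (fun v => lam v * f (par v)) 2 := by
  rw [memlp_two_iff, tsum_enorm_shift_sq]
  exact hf

theorem shiftOp_apply {par : V → V} {lam : V → ℂ} {f : HS V} (hf : f ∈ (shiftOp par lam).dom)
    (v : V) : (shiftOp par lam).toFun f v = lam v * f (par v) :=
  mkH_apply (memlp_shift hf) v

theorem enorm_shiftOp_sq {par : V → V} {lam : V → ℂ} {f : HS V}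
    (hf : f ∈ (shiftOp par lam).dom) :
    ‖(shiftOp par lam).toFun f‖ₑ ^ 2 = ∑' u, childSq par lam u * ‖f u‖ₑ ^ 2 := by
  simp only [enorm_sq_eq_tsum, shiftOp_apply hf, tsum_enorm_shift_sq]

theorem inner_shiftOp {par : V → V} {lam : V → ℂ} {f : HS V}
    (hf : f ∈ (shiftOp par lam).dom) (g : HS V) :
    ⟪(shiftOp par lam).toFun f, g⟫ = ∑' u, conj (f u) * shiftFormalAdj par lam g u := by
  have hs := lp.summable_inner (𝕜 := ℂ) ((shiftOp par lam).toFun f) g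
  refine (lp.inner_eq_tsum _ _).trans (((Equiv.sigmaFiberEquiv par).tsum_eq _).symm.trans
    ((((Equiv.sigmaFiberEquiv par).summable_iff.mpr hs).tsum_sigma).trans ?_))
  refine tsum_congr fun u => ?_
  rw [shiftFormalAdj, ← tsum_mul_left]
  refine tsum_congr fun v => ?_
  simp only [Function.comp_apply, Equiv.sigmaFiberEquiv_apply, shiftOp_apply hf, RCLike.inner_apply, map_mul, v.2]
  ring

theorem sum_single_apply (s : Finset V) (a : V → ℂ) (w : V) :
    (∑ v ∈ s, lp.single 2 v (a v) : HS V) w = if w ∈ s then a w else 0 := by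
  simp only [lp.coeFn_single, lp.coeFn_sum, Finset.sum_apply, Finset.sum_pi_single]

theorem tsum_childSq_sum_single (par : V → V) (lam : V → ℂ) (s : Finset V) (a : V → ℂ) :
    ∑' u, childSq par lam u * ‖(∑ v ∈ s, lp.single 2 v (a v) : HS V) u‖ₑ ^ 2 =
      ∑ v ∈ s, childSq par lam v * ‖a v‖ₑ ^ 2 := by
  rw [tsum_eq_sum (s := s) fun v hv => by rw [sum_single_apply, if_neg hv]; simp]
  refine Finset.sum_congr rfl fun v hv => ?_
  rw [sum_single_apply, if_pos hv]

theorem sum_single_mem_dom {par : V → V} {lam : V → ℂ} (hc : ∀ u, childSq par lam u ≠ ⊤)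
    (s : Finset V) (a : V → ℂ) :
    (∑ v ∈ s, lp.single 2 v (a v) : HS V) ∈ (shiftOp par lam).dom := by
  rw [mem_shiftOp_dom, tsum_childSq_sum_single]
  exact ENNReal.sum_lt_top.mpr fun v _ =>
    ENNReal.mul_lt_top (hc v).lt_top (ENNReal.pow_lt_top enorm_lt_top)

theorem dense_shiftOp_dom {par : V → V} {lam : V → ℂ} (hc : ∀ u, childSq par lam u ≠ ⊤) :
    Dense (shiftOp par lam).dom := fun f =>
  mem_closure_of_tendsto (lp.hasSum_single (by norm_num) f)
    (.of_forall fun s => sum_single_mem_dom hc s f)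

theorem eq_shiftFormalAdj {par : V → V} {lam : V → ℂ} (hc : ∀ u, childSq par lam u ≠ ⊤)
    {g h : HS V} (hh : ∀ f ∈ (shiftOp par lam).dom, ⟪(shiftOp par lam).toFun f, g⟫ = ⟪f, h⟫)
    (u : V) : h u = shiftFormalAdj par lam g u := by
  have hd := sum_single_mem_dom hc {u} 1
  have := hh _ hd
  rw [inner_shiftOp hd, lp.inner_eq_tsum, tsum_eq_single u fun v hv => by simp [hv],
    tsum_eq_single u fun v hv => by simp [hv]] at this
  simpa using this.symm

theorem mem_adj_dom {par : V → V} {lam : V → ℂ} {g : HS V}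
    (hg : Memℓp (shiftFormalAdj par lam g) 2) : g ∈ (shiftOp par lam).adj.dom := by
  refine ⟨mkH (shiftFormalAdj par lam g), fun f hf => ?_⟩
  rw [inner_shiftOp hf, lp.inner_eq_tsum]
  refine tsum_congr fun u => ?_
  rw [mkH_apply hg, RCLike.inner_apply, mul_comm]

theorem adj_apply {par : V → V} {lam : V → ℂ} (hc : ∀ u, childSq par lam u ≠ ⊤)
    {g : HS V} (hg : g ∈ (shiftOp par lam).adj.dom) (u : V) :
    (shiftOp par lam).adj.toFun g u = shiftFormalAdj par lam g u := by
  have hg' : ∃ h, ∀ f ∈ (shiftOp par lam).dom, ⟪(shiftOp par lam).toFun f, g⟫ = ⟪f, h⟫ := hg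
  rw [show (shiftOp par lam).adj.toFun g = hg'.choose from dif_pos hg']
  exact eq_shiftFormalAdj hc hg'.choose_spec u

theorem shiftFormalAdj_sum_single {par : V → V} (lam : V → ℂ) {u : V} {s : Finset V}
    (hs : ∀ v ∈ s, par v = u) (a : V → ℂ) :
    shiftFormalAdj par lam (∑ v ∈ s, lp.single 2 v (a v) : HS V) u =
      ∑ v ∈ s, conj (lam v) * a v := by
  unfold shiftFormalAdj
  refine (tsum_subtype {v | par v = u}
    fun v => conj (lam v) * (∑ v ∈ s, lp.single 2 v (a v) : HS V) v).trans ?_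
  simp only [Set.indicator_apply, Set.mem_ofPred_eq]
  rw [tsum_eq_sum (s := s) fun v hv => by
    rw [sum_single_apply, if_neg hv, mul_zero, ite_self]]
  refine Finset.sum_congr rfl fun v hv => ?_
  rw [if_pos (hs v hv), sum_single_apply, if_pos hv]

theorem enorm_sum_sq_le_of_hyponormal {par : V → V} {lam : V → ℂ}
    (hc : ∀ u, childSq par lam u ≠ ⊤)
    (hdom : (shiftOp par lam).dom ⊆ (shiftOp par lam).adj.dom)
    (hnorm : ∀ f ∈ (shiftOp par lam).dom,
      ‖(shiftOp par lam).adj.toFun f‖ ≤ ‖(shiftOp par lam).toFun f‖)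
    {u : V} {s : Finset V} (hs : ∀ v ∈ s, par v = u) (a : V → ℂ) :
    ‖∑ v ∈ s, conj (lam v) * a v‖ₑ ^ 2 ≤ ∑ v ∈ s, childSq par lam v * ‖a v‖ₑ ^ 2 := by
  have hd := sum_single_mem_dom hc s a
  rw [← shiftFormalAdj_sum_single lam hs, ← adj_apply hc (hdom hd), ← tsum_childSq_sum_single,
    ← enorm_shiftOp_sq hd]
  refine (ENNReal.le_tsum u).trans ((enorm_sq_eq_tsum _).symm.trans_le ?_)
  exact pow_le_pow_left' (enorm_le_iff_norm_le.mpr (hnorm _ hd)) 2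

theorem enorm_shiftFormalAdj_sq_le {par : V → V} {lam : V → ℂ}
    (hl : ∀ u : V, Summable fun v : {v : V // par v = u} => ‖lam v.1‖ ^ 2) {u : V}
    (h0 : ∀ v : V, par v = u → cW par lam v = 0 → lam v = 0)
    (h1 : (∑' v : {v : V // par v = u ∧ 0 < cW par lam v},
      ENNReal.ofReal (‖lam v.1‖ ^ 2 / cW par lam v.1 ^ 2)) ≤ 1) (g : V → ℂ) :
    ‖shiftFormalAdj par lam g u‖ₑ ^ 2 ≤
      ∑' v : {v : V // par v = u}, childSq par lam v.1 * ‖g v.1‖ₑ ^ 2 := by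
  have hle : ‖shiftFormalAdj par lam g u‖ₑ ≤ ∑' v : {v : V // par v = u},
      ENNReal.ofReal (‖lam v.1‖ / cW par lam v.1) *
        (ENNReal.ofReal (cW par lam v.1) * ‖g v.1‖ₑ) := by
    refine enorm_tsum_le_tsum_enorm.trans_eq (tsum_congr fun v => ?_)
    rw [← mul_assoc, ← ENNReal.ofReal_mul (div_nonneg (norm_nonneg _) (cW_nonneg ..)),
      div_mul_cancel_of_imp fun h => by simp [h0 v v.2 h], ofReal_norm, enorm_mul]
    simp
  have hsum : ∑' v : {v : V // par v = u}, ENNReal.ofReal (‖lam v.1‖ / cW par lam v.1) ^ 2 ≤ 1 := by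
    refine le_of_eq_of_le ?_ h1
    refine (tsum_subtype {v | par v = u}
      fun v => ENNReal.ofReal (‖lam v‖ / cW par lam v) ^ 2).trans ?_
    refine Eq.trans (tsum_congr fun v => ?_)
      (tsum_subtype {v | par v = u ∧ 0 < cW par lam v}
        fun v => ENNReal.ofReal (‖lam v‖ ^ 2 / cW par lam v ^ 2)).symm
    have hcv := cW_nonneg par lam v
    simp only [← div_pow]
    rcases hcv.eq_or_lt with h | h
    · simp [Set.indicator, ← h]
    · simp [Set.indicator, h, ENNReal.ofReal_pow (div_nonneg (norm_nonneg (lam v)) hcv)]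
  calc _ ≤ _ := pow_le_pow_left' hle 2
    _ ≤ _ := ENNReal.tsum_mul_sq_le _ _
    _ ≤ 1 * _ := mul_le_mul_left hsum _
    _ = _ := by
      rw [one_mul]
      refine tsum_congr fun v => ?_
      rw [mul_pow, ← ENNReal.ofReal_pow (cW_nonneg ..), ofReal_cW_sq (hl _)]

theorem sum_div_cW_le_one {par : V → V} {lam : V → ℂ}
    (hl : ∀ u : V, Summable fun v : {v : V // par v = u} => ‖lam v.1‖ ^ 2)
    {s : Finset V} (hpos : ∀ v ∈ s, 0 < cW par lam v)
    (h : ∀ a : V → ℂ,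
      ‖∑ v ∈ s, conj (lam v) * a v‖ₑ ^ 2 ≤ ∑ v ∈ s, childSq par lam v * ‖a v‖ₑ ^ 2) :
    ∑ v ∈ s, ‖lam v‖ ^ 2 / cW par lam v ^ 2 ≤ 1 := by
  have key := h fun v => lam v / (cW par lam v ^ 2 : ℝ)
  have hL : ∑ v ∈ s, conj (lam v) * (lam v / (cW par lam v ^ 2 : ℝ)) =
      ((∑ v ∈ s, ‖lam v‖ ^ 2 / cW par lam v ^ 2 : ℝ) : ℂ) := by
    push_cast
    refine Finset.sum_congr rfl fun v _ => ?_
    rw [← mul_div_assoc, Complex.conj_mul']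
  have hR : ∑ v ∈ s, childSq par lam v * ‖lam v / (cW par lam v ^ 2 : ℝ)‖ₑ ^ 2 =
      ENNReal.ofReal (∑ v ∈ s, ‖lam v‖ ^ 2 / cW par lam v ^ 2) := by
    rw [ENNReal.ofReal_sum_of_nonneg fun _ _ => by positivity]
    refine Finset.sum_congr rfl fun v hv => ?_
    have := (hpos v hv).ne'
    rw [← ofReal_cW_sq (hl v), enorm_sq_eq_ofReal, ← ENNReal.ofReal_mul (by positivity),
      norm_div, Complex.norm_real, Real.norm_of_nonneg (by positivity)]
    congr 1
    field_simp
  have hS : 0 ≤ ∑ v ∈ s, ‖lam v‖ ^ 2 / cW par lam v ^ 2 :=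
    Finset.sum_nonneg fun _ _ => by positivity
  rw [hL, hR, enorm_sq_eq_ofReal, Complex.norm_real, Real.norm_of_nonneg hS,
    ENNReal.ofReal_le_ofReal_iff hS] at key
  nlinarith

/-- Theorem 2.3, criterion for hyponormality: a densely defined
weighted shift `S_λ` is hyponormal iff for every `u ∈ V`: (1) `λ v = 0` for every child
`v` of `u` with `c(v) = 0`, and (2) `Σ_{v ∈ Chi(u), c(v) > 0} |λ v|²/c(v)² ≤ 1`. -/
theorem statement_17 (V : Type*) [Nonempty V] (par : V → V)
    (ha : ∀ u v : V, ∃ m n : ℕ, par^[m] u = par^[n] v)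
    (hb : ∀ (v : V) (n : ℕ), 1 ≤ n → par^[n] v ≠ v)
    (lam : V → ℂ)
    (hl : ∀ u : V, Summable fun v : {v : V // par v = u} => ‖lam v.1‖ ^ 2) :
    (Dense (shiftOp par lam).dom ∧
      (shiftOp par lam).dom ⊆ (shiftOp par lam).adj.dom ∧
      ∀ f ∈ (shiftOp par lam).dom,
        ‖(shiftOp par lam).adj.toFun f‖ ≤ ‖(shiftOp par lam).toFun f‖)
    ↔ ∀ u : V,
        (∀ v : V, par v = u → cW par lam v = 0 → lam v = 0) ∧
        (∑' v : {v : V // par v = u ∧ 0 < cW par lam v},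
            ENNReal.ofReal (‖lam v.1‖ ^ 2 / cW par lam v.1 ^ 2)) ≤ 1 := by
  have hc (u : V) : childSq par lam u ≠ ⊤ := ofReal_cW_sq (hl u) ▸ ENNReal.ofReal_ne_top
  constructor
  · rintro ⟨-, hdom, hnorm⟩ u
    refine ⟨fun v hv hv0 => ?_, ?_⟩
    · have h := enorm_sum_sq_le_of_hyponormal hc hdom hnorm (s := {v}) (u := u) (by simpa) 1
      simpa [← ofReal_cW_sq (hl v), hv0] using h
    · refine ENNReal.summable.tsum_le_of_sum_le fun t => ?_
      rw [← ENNReal.ofReal_sum_of_nonneg fun _ _ => by positivity, ENNReal.ofReal_le_one]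
      have h := sum_div_cW_le_one hl (s := t.map (Function.Embedding.subtype _))
        (by simp +contextual) fun a =>
          enorm_sum_sq_le_of_hyponormal hc hdom hnorm (u := u) (by simp +contextual) a
      simpa using h
  · intro h
    have hle (f : HS V) : ∑' u, ‖shiftFormalAdj par lam f u‖ₑ ^ 2 ≤
        ∑' u, childSq par lam u * ‖f u‖ₑ ^ 2 :=
      (ENNReal.tsum_le_tsum fun u => enorm_shiftFormalAdj_sq_le hl (h u).1 (h u).2 f).trans_eq
        (ENNReal.tsum_fiberwise (fun v => childSq par lam v * ‖f v‖ₑ ^ 2) par)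
    have hdom : (shiftOp par lam).dom ⊆ (shiftOp par lam).adj.dom := fun f hf =>
      mem_adj_dom ((memlp_two_iff _).mpr ((hle f).trans_lt hf))
    refine ⟨dense_shiftOp_dom hc, hdom, fun f hf => ?_⟩
    rw [← enorm_le_iff_norm_le, ← ENNReal.pow_le_pow_left_iff two_ne_zero, enorm_shiftOp_sq hf,
      enorm_sq_eq_tsum]
    simpa only [adj_apply hc (hdom hf)] using hle f
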